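/- Let X be a complex m×n matrix of rank r and let k be a natural number with k ≥ r. Then there exist a complex k×m matrix L and a complex k×n matrix R such that X = L*R, ‖X‖_S = ‖L‖_c · ‖R‖_c, and the range (column space) of L equals the range of R. Moreover, ‖X‖_S = min{ ‖L̂‖_c · ‖R̂‖_c : k' ∈ ℕ, L̂ a complex k'×m matrix, R̂ a complex k'×n matrix, X = L̂*R̂ }; in particular ‖L̂‖_c · ‖R̂‖_c ≥ ‖X‖_S for every such factorization. -/

import Mathlib

open Matrix
open scoped ComplexOrder

noncomputable section

namespace MatFact

/-- ℓ² norm of a complex vector. -/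
def vnorm {n : ℕ} (v : Fin n → ℂ) : ℝ := Real.sqrt (∑ j, ‖v j‖ ^ 2)

/-- Operator norm of a matrix as a map ℓ²(Fin n) → ℓ²(Fin m). -/
def opNorm {m n : ℕ} (X : Matrix (Fin m) (Fin n) ℂ) : ℝ :=
  sSup {c : ℝ | ∃ v : Fin n → ℂ, vnorm v ≤ 1 ∧ c = vnorm (X.mulVec v)}

/-- Column norm: the maximal ℓ² norm of a column. -/
def colNorm {m n : ℕ} (X : Matrix (Fin m) (Fin n) ℂ) : ℝ :=
  ⨆ j : Fin n, vnorm (fun i => X i j)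

/-- Hilbert–Schmidt (Frobenius) norm. -/
def frobNorm {m n : ℕ} (X : Matrix (Fin m) (Fin n) ℂ) : ℝ :=
  Real.sqrt (∑ i, ∑ j, ‖X i j‖ ^ 2)

/-- Schur norm: operator norm of Schur (entrywise) multiplication by `X`
on matrices with the operator norm. -/
def schurNorm {m n : ℕ} (X : Matrix (Fin m) (Fin n) ℂ) : ℝ :=
  sSup {c : ℝ | ∃ A : Matrix (Fin m) (Fin n) ℂ, opNorm A ≤ 1 ∧
    c = opNorm (Matrix.hadamard X A)}

/-- The T-norm (bilinear Schur norm). -/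
def Tnorm {m n : ℕ} (X : Matrix (Fin m) (Fin n) ℂ) : ℝ :=
  sSup {c : ℝ | ∃ (a : Fin m → ℂ) (B : Matrix (Fin m) (Fin n) ℂ),
    (∀ i, ‖a i‖ ≤ 1) ∧ opNorm B ≤ 1 ∧
    c = vnorm (fun j => ∑ i, a i * X i j * B i j)}

/-- The F-norm: operator norm of `X` from `ℂⁿ` with the sup norm to `ℂᵐ`
with the ℓ² norm. -/
def Fnorm {m n : ℕ} (X : Matrix (Fin m) (Fin n) ℂ) : ℝ :=
  sSup {c : ℝ | ∃ v : Fin n → ℂ, (∀ j, ‖v j‖ ≤ 1) ∧ c = vnorm (X.mulVec v)}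

/-- The bilinear form norm. -/
def Bnorm {m n : ℕ} (Y : Matrix (Fin m) (Fin n) ℂ) : ℝ :=
  sSup {c : ℝ | ∃ (a : Fin m → ℂ) (b : Fin n → ℂ), (∀ i, ‖a i‖ ≤ 1) ∧
    (∀ j, ‖b j‖ ≤ 1) ∧ c = ‖∑ i, ∑ j, Y i j * a i * b j‖}

/-- The completely bounded F-norm. -/
def cbF {m n : ℕ} (X : Matrix (Fin m) (Fin n) ℂ) : ℝ :=
  sInf {c : ℝ | ∃ (A : Matrix (Fin m) (Fin n) ℂ) (ξ : Fin n → ℂ),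
    X = A * Matrix.diagonal ξ ∧ c = opNorm A * vnorm ξ}

/-- The completely bounded bilinear form norm. -/
def cbB {m n : ℕ} (X : Matrix (Fin m) (Fin n) ℂ) : ℝ :=
  sInf {c : ℝ | ∃ (η : Fin m → ℂ) (B : Matrix (Fin m) (Fin n) ℂ) (ξ : Fin n → ℂ),
    X = Matrix.diagonal η * B * Matrix.diagonal ξ ∧
    c = vnorm η * opNorm B * vnorm ξ}

/-- The range (column space) of a matrix, as a submodule of `ℂᵐ`. -/
def ran {m n : ℕ} (X : Matrix (Fin m) (Fin n) ℂ) : Submodule ℂ (Fin m → ℂ) :=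
  LinearMap.range X.mulVecLin

/-- `P` is the orthogonal projection onto the subspace `E`, i.e. `P` is a
Hermitian idempotent with range `E`. -/
def IsOrthProjOnto {n : ℕ} (P : Matrix (Fin n) (Fin n) ℂ)
    (E : Submodule ℂ (Fin n → ℂ)) : Prop :=
  P.IsHermitian ∧ P * P = P ∧ ran P = E

/-- `W` is a partial isometry with support `E` and range `F`. -/
def IsPartialIsometryFromTo {m n : ℕ} (W : Matrix (Fin m) (Fin n) ℂ)
    (E : Submodule ℂ (Fin n → ℂ)) (F : Submodule ℂ (Fin m → ℂ)) : Prop :=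
  IsOrthProjOnto (Wᴴ * W) E ∧ IsOrthProjOnto (W * Wᴴ) F

/-- A cb operator factorization of `X`. -/
def IsCbOpFact {m n : ℕ} (X A : Matrix (Fin m) (Fin n) ℂ) (ξ : Fin n → ℂ) : Prop :=
  (∀ j, 0 ≤ ξ j) ∧ vnorm ξ = 1 ∧ opNorm A = cbF X ∧
  (∀ j, ξ j = 0 → ∀ i, A i j = 0) ∧ X = A * Matrix.diagonal ξ

/-- A cb bilinear form factorization of `X`. -/
def IsCbBilFact {m n : ℕ} (X : Matrix (Fin m) (Fin n) ℂ) (η : Fin m → ℂ)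
    (B : Matrix (Fin m) (Fin n) ℂ) (ξ : Fin n → ℂ) : Prop :=
  (∀ i, 0 ≤ η i) ∧ (∀ j, 0 ≤ ξ j) ∧ vnorm η = 1 ∧ vnorm ξ = 1 ∧
  opNorm B = cbB X ∧ (∀ j, ξ j = 0 → ∀ i, B i j = 0) ∧
  (∀ i, η i = 0 → ∀ j, B i j = 0) ∧ X = Matrix.diagonal η * B * Matrix.diagonal ξ

/-- A Schur factorization of `X`. -/
def IsSchurFact {m n : ℕ} (X : Matrix (Fin m) (Fin n) ℂ)
    (F : Matrix (Fin m) (Fin m) ℂ) (W : Matrix (Fin m) (Fin n) ℂ)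
    (G : Matrix (Fin n) (Fin n) ℂ) : Prop :=
  F.PosSemidef ∧ (∀ i, (F * F) i i ≤ 1) ∧ G.PosSemidef ∧ (∀ j, (G * G) j j ≤ 1) ∧
  IsPartialIsometryFromTo W (ran G) (ran F) ∧
  X = (schurNorm X : ℂ) • (F * W * G)

/-- A bilinear Schur factorization of `X`. -/
def IsBilinSchurFact {m n : ℕ} (X : Matrix (Fin m) (Fin n) ℂ)
    (T : Matrix (Fin m) (Fin m) ℂ) (W : Matrix (Fin m) (Fin n) ℂ)
    (G : Matrix (Fin n) (Fin n) ℂ) : Prop :=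
  T.PosSemidef ∧ frobNorm T = Tnorm X ∧ G.PosSemidef ∧ (∀ j, (G * G) j j ≤ 1) ∧
  IsPartialIsometryFromTo W (ran G) (ran T) ∧ X = T * W * G

/-- Maximal diagonal entry (real part) of a square matrix. -/
def maxDiag {n : ℕ} (P : Matrix (Fin n) (Fin n) ℂ) : ℝ := ⨆ i, (P i i).re

end MatFact

namespace MatFact

lemma vnorm_eq_norm {n : ℕ} (v : Fin n → ℂ) : vnorm v = ‖WithLp.toLp 2 v‖ := by
  rw [EuclideanSpace.norm_eq, vnorm]

lemma vnorm_nonneg {n : ℕ} (v : Fin n → ℂ) : 0 ≤ vnorm v := Real.sqrt_nonneg _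

lemma vnorm_sq {n : ℕ} (v : Fin n → ℂ) : vnorm v ^ 2 = ∑ j, ‖v j‖ ^ 2 :=
  Real.sq_sqrt (by positivity)

lemma norm_star_dotProduct_le {n : ℕ} (u v : Fin n → ℂ) :
    ‖star u ⬝ᵥ v‖ ≤ vnorm u * vnorm v := by
  have h := norm_inner_le_norm (𝕜 := ℂ) (WithLp.toLp 2 u) (WithLp.toLp 2 v)
  rwa [EuclideanSpace.inner_toLp_toLp, dotProduct_comm, ← vnorm_eq_norm, ← vnorm_eq_norm] at h

lemma star_dotProduct_self {n : ℕ} (u : Fin n → ℂ) : star u ⬝ᵥ u = ((vnorm u ^ 2 : ℝ) : ℂ) := by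
  simp [vnorm_sq, dotProduct, Complex.conj_mul']

open scoped Matrix.Norms.L2Operator in
lemma vnorm_mulVec_le_l2 {m n : ℕ} (A : Matrix (Fin m) (Fin n) ℂ) (v : Fin n → ℂ) :
    vnorm (A *ᵥ v) ≤ ‖A‖ * vnorm v := by
  rw [vnorm_eq_norm, vnorm_eq_norm]
  exact l2_opNorm_mulVec A (WithLp.toLp 2 v)

lemma opNorm_le {m n : ℕ} {A : Matrix (Fin m) (Fin n) ℂ} {c : ℝ}
    (h : ∀ v, vnorm v ≤ 1 → vnorm (A *ᵥ v) ≤ c) : opNorm A ≤ c := by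
  refine csSup_le ⟨_, 0, by simp [vnorm], rfl⟩ ?_
  rintro _ ⟨v, hv, rfl⟩
  exact h v hv

open scoped Matrix.Norms.L2Operator in
lemma vnorm_mulVec_le_of_vnorm_le_one {m n : ℕ} (A : Matrix (Fin m) (Fin n) ℂ) {v : Fin n → ℂ}
    (hv : vnorm v ≤ 1) : vnorm (A *ᵥ v) ≤ opNorm A := by
  refine le_csSup ⟨‖A‖, ?_⟩ ⟨v, hv, rfl⟩
  rintro _ ⟨w, hw, rfl⟩
  exact (vnorm_mulVec_le_l2 A w).trans (mul_le_of_le_one_right (norm_nonneg _) hw)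

lemma opNorm_nonneg {m n : ℕ} (A : Matrix (Fin m) (Fin n) ℂ) : 0 ≤ opNorm A :=
  (vnorm_nonneg _).trans (vnorm_mulVec_le_of_vnorm_le_one A (v := 0) (by simp [vnorm]))

lemma vnorm_smul {n : ℕ} (c : ℂ) (v : Fin n → ℂ) : vnorm (c • v) = ‖c‖ * vnorm v := by
  rw [vnorm_eq_norm, vnorm_eq_norm, WithLp.toLp_smul, norm_smul]

lemma vnorm_mulVec_le {m n : ℕ} (A : Matrix (Fin m) (Fin n) ℂ) (v : Fin n → ℂ) :
    vnorm (A *ᵥ v) ≤ opNorm A * vnorm v := by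
  rcases (vnorm_nonneg v).eq_or_lt with h | h
  · have hv : v = 0 := by
      rw [vnorm_eq_norm, eq_comm, norm_eq_zero] at h
      simpa using h
    simp [hv, vnorm]
  · have h1 : vnorm (((vnorm v)⁻¹ : ℂ) • v) ≤ 1 := by
      rw [vnorm_smul, norm_inv, Complex.norm_real, Real.norm_of_nonneg h.le,
        inv_mul_cancel₀ h.ne']
    have h2 := vnorm_mulVec_le_of_vnorm_le_one A h1
    rwa [mulVec_smul, vnorm_smul, norm_inv, Complex.norm_real, Real.norm_of_nonneg h.le,
      inv_mul_le_iff₀ h, mul_comm] at h2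

lemma vnorm_col_le {m n : ℕ} (X : Matrix (Fin m) (Fin n) ℂ) (j : Fin n) :
    vnorm (fun i => X i j) ≤ colNorm X :=
  le_ciSup (f := fun j => vnorm (fun i => X i j)) (Set.finite_range _).bddAbove j

lemma colNorm_nonneg {m n : ℕ} (X : Matrix (Fin m) (Fin n) ℂ) : 0 ≤ colNorm X :=
  Real.iSup_nonneg fun _ => vnorm_nonneg _

lemma colNorm_le {m n : ℕ} {X : Matrix (Fin m) (Fin n) ℂ} {c : ℝ} (hc : 0 ≤ c)
    (h : ∀ j, vnorm (fun i => X i j) ≤ c) : colNorm X ≤ c :=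
  Real.iSup_le h hc

lemma sum_vnorm_row_mul_sq_le {m n : ℕ} (R : Matrix (Fin m) (Fin n) ℂ) (v : Fin n → ℂ) :
    ∑ k, vnorm (R k * v) ^ 2 ≤ (colNorm R * vnorm v) ^ 2 := by
  simp_rw [mul_pow, vnorm_sq, Pi.mul_apply, norm_mul, mul_pow]
  rw [Finset.sum_comm, Finset.mul_sum]
  refine Finset.sum_le_sum fun j _ => ?_
  rw [← Finset.sum_mul, ← vnorm_sq (fun k => R k j)]
  gcongr
  exacts [vnorm_nonneg _, vnorm_col_le R j]

lemma star_dotProduct_hadamard_mulVec {m n k : ℕ} (L : Matrix (Fin k) (Fin m) ℂ)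
    (R : Matrix (Fin k) (Fin n) ℂ) (A : Matrix (Fin m) (Fin n) ℂ) (u : Fin m → ℂ)
    (v : Fin n → ℂ) :
    star u ⬝ᵥ (hadamard (Lᴴ * R) A *ᵥ v) = ∑ l, star (L l * u) ⬝ᵥ (A *ᵥ (R l * v)) := by
  simp only [dotProduct, mulVec, hadamard_apply, mul_apply, conjTranspose_apply, Pi.mul_apply,
    Pi.star_apply, star_mul', Finset.mul_sum, Finset.sum_mul]
  conv_rhs => rw [Finset.sum_comm]
  refine Finset.sum_congr rfl fun i _ => ?_
  conv_rhs => rw [Finset.sum_comm]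
  refine Finset.sum_congr rfl fun j _ => Finset.sum_congr rfl fun l _ => ?_
  ring

lemma opNorm_hadamard_le {m n k : ℕ} (L : Matrix (Fin k) (Fin m) ℂ)
    (R : Matrix (Fin k) (Fin n) ℂ) (A : Matrix (Fin m) (Fin n) ℂ) :
    opNorm (hadamard (Lᴴ * R) A) ≤ colNorm L * colNorm R * opNorm A := by
  refine opNorm_le fun v hv => ?_
  set u := hadamard (Lᴴ * R) A *ᵥ v with hu
  have hL := colNorm_nonneg L
  have hR := colNorm_nonneg R
  have hA := opNorm_nonneg A
  have hu0 := vnorm_nonneg u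
  have hv0 := vnorm_nonneg v
  have key := star_dotProduct_hadamard_mulVec L R A u v
  rw [← hu] at key
  have h1 : vnorm u ^ 2 ≤ opNorm A * ((colNorm L * vnorm u) * (colNorm R * vnorm v)) := by
    calc vnorm u ^ 2 = ‖star u ⬝ᵥ u‖ := by
          rw [star_dotProduct_self, Complex.norm_real, Real.norm_of_nonneg (sq_nonneg _)]
      _ ≤ ∑ l, ‖star (L l * u) ⬝ᵥ (A *ᵥ (R l * v))‖ := key ▸ norm_sum_le _ _
      _ ≤ ∑ l, opNorm A * (vnorm (L l * u) * vnorm (R l * v)) := by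
          refine Finset.sum_le_sum fun l _ => (norm_star_dotProduct_le _ _).trans ?_
          rw [mul_left_comm]
          exact mul_le_mul_of_nonneg_left (vnorm_mulVec_le A _) (vnorm_nonneg _)
      _ ≤ opNorm A * ((colNorm L * vnorm u) * (colNorm R * vnorm v)) := by
          rw [← Finset.mul_sum]
          refine mul_le_mul_of_nonneg_left ?_ hA
          refine (Real.sum_mul_le_sqrt_mul_sqrt _ _ _).trans ?_
          gcongr
          · exact Real.sqrt_le_iff.2 ⟨by positivity, sum_vnorm_row_mul_sq_le L u⟩
          · exact Real.sqrt_le_iff.2 ⟨by positivity, sum_vnorm_row_mul_sq_le R v⟩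
  rcases hu0.eq_or_lt with h | h
  · rw [← h]; positivity
  · have h2 : vnorm u ≤ colNorm L * colNorm R * opNorm A * vnorm v := by
      refine le_of_mul_le_mul_right ?_ h
      calc vnorm u * vnorm u = vnorm u ^ 2 := (sq _).symm
        _ ≤ _ := h1
        _ = _ := by ring
    exact h2.trans (mul_le_of_le_one_right (by positivity) hv)

lemma schurNorm_le {m n k : ℕ} (L : Matrix (Fin k) (Fin m) ℂ) (R : Matrix (Fin k) (Fin n) ℂ) :
    schurNorm (Lᴴ * R) ≤ colNorm L * colNorm R := by
  refine csSup_le ⟨_, 0, opNorm_le fun v _ => by simp [vnorm], rfl⟩ ?_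
  rintro _ ⟨A, hA, rfl⟩
  exact (opNorm_hadamard_le L R A).trans
    (mul_le_of_le_one_right (mul_nonneg (colNorm_nonneg L) (colNorm_nonneg R)) hA)

lemma opNorm_hadamard_le_schurNorm {m n : ℕ} (X : Matrix (Fin m) (Fin n) ℂ)
    {A : Matrix (Fin m) (Fin n) ℂ} (hA : opNorm A ≤ 1) :
    opNorm (hadamard X A) ≤ schurNorm X := by
  refine le_csSup ⟨colNorm (1 : Matrix (Fin m) (Fin m) ℂ) * colNorm X, ?_⟩ ⟨A, hA, rfl⟩
  rintro _ ⟨B, hB, rfl⟩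
  have h := opNorm_hadamard_le 1 X B
  rw [conjTranspose_one, Matrix.one_mul] at h
  exact h.trans (mul_le_of_le_one_right (mul_nonneg (colNorm_nonneg _) (colNorm_nonneg X)) hB)

lemma schurNorm_nonneg {m n : ℕ} (X : Matrix (Fin m) (Fin n) ℂ) : 0 ≤ schurNorm X :=
  (opNorm_nonneg _).trans
    (opNorm_hadamard_le_schurNorm X (A := 0) (opNorm_le fun v _ => by simp [vnorm]))

open scoped Matrix.Norms.L2Operator in
/-- A weak polar decomposition: every matrix `Y` is the corner of a positive semidefinite block
matrix whose trace is twice the pairing of `Y` with some contraction. -/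
lemma exists_posSemidef_fromBlocks_trace {m n : ℕ} (Y : Matrix (Fin m) (Fin n) ℂ) :
    ∃ (U : Matrix (Fin m) (Fin n) ℂ) (P : Matrix (Fin m) (Fin m) ℂ)
      (Q : Matrix (Fin n) (Fin n) ℂ), ‖U‖ ≤ 1 ∧ (fromBlocks P Y Yᴴ Q).PosSemidef ∧
      (fromBlocks P Y Yᴴ Q).trace = 2 * (Uᴴ * Y).trace := by
  have hpos := posSemidef_conjTranspose_mul_self Y
  set lam := hpos.1.eigenvalues
  have hlam0 : ∀ i, 0 ≤ lam i := hpos.eigenvalues_nonneg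
  set V : Matrix (Fin n) (Fin n) ℂ := ↑hpos.1.eigenvectorUnitary
  have hVV : Vᴴ * V = 1 := Unitary.coe_star_mul_self hpos.1.eigenvectorUnitary
  have hVV' : V * Vᴴ = 1 := Unitary.coe_mul_star_self hpos.1.eigenvectorUnitary
  have hspec : Yᴴ * Y = V * diagonal (fun i => (lam i : ℂ)) * Vᴴ := by
    conv_lhs => rw [hpos.1.spectral_theorem, Unitary.conjStarAlgAut_apply]
    rfl
  set s : Fin n → ℂ := fun i => (√(lam i) : ℝ) with hs
  have hss : ∀ i, s i * s i = lam i := fun i => by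
    rw [hs, ← Complex.ofReal_mul, Real.mul_self_sqrt (hlam0 i)]
  have hstar : star s = s := by ext i; simp [hs]
  have hstar' : star s⁻¹ = s⁻¹ := by ext i; simp [hs]
  set Z := Y * V with hZ
  have hZZ : Zᴴ * Z = diagonal (fun i => (lam i : ℂ)) := by
    rw [hZ, conjTranspose_mul, Matrix.mul_assoc, ← Matrix.mul_assoc Yᴴ, hspec]
    simp only [Matrix.mul_assoc, hVV, Matrix.mul_one]
    rw [← Matrix.mul_assoc, hVV, Matrix.one_mul]
  set B := Z * diagonal s⁻¹ with hB
  set e : Fin n → ℂ := fun i => if s i = 0 then 0 else 1 with he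
  have hBB : Bᴴ * B = diagonal e := by
    rw [hB, conjTranspose_mul, Matrix.mul_assoc, ← Matrix.mul_assoc Zᴴ, hZZ,
      diagonal_conjTranspose, diagonal_mul_diagonal, diagonal_mul_diagonal, hstar']
    congr 1
    ext i
    rw [← hss i, Pi.inv_apply]
    by_cases h : s i = 0
    · simp [he, h]
    · simp [he, h]
  have hZB : B * diagonal s = Z := by
    ext i j
    rw [hB, mul_diagonal, mul_diagonal, Pi.inv_apply]
    by_cases h : s j = 0
    · have h0 : (Zᴴ * Z) j j = 0 := by rw [hZZ, diagonal_apply_eq, ← hss j, h, mul_zero]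
      have h1 : ∑ l, ((‖Z l j‖ ^ 2 : ℝ) : ℂ) = 0 := by
        rw [← h0, mul_apply]
        simp [Complex.conj_mul']
      rw [← Complex.ofReal_sum, Complex.ofReal_eq_zero,
        Finset.sum_eq_zero_iff_of_nonneg fun _ _ => sq_nonneg _] at h1
      have h2 : Z i j = 0 := by simpa using h1 i (Finset.mem_univ i)
      simp [h2]
    · rw [inv_mul_cancel_right₀ h]
  have hY : B * diagonal s * Vᴴ = Y := by
    rw [hZB, hZ, Matrix.mul_assoc, hVV', Matrix.mul_one]
  have hes : diagonal e * diagonal s = diagonal s := by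
    rw [diagonal_mul_diagonal]
    congr 1
    ext i
    by_cases h : s i = 0 <;> simp [he, h]
  have hblock : fromBlocks (B * diagonal s * Bᴴ) Y Yᴴ (V * diagonal s * Vᴴ) =
      fromRows B V * diagonal s * (fromRows B V)ᴴ := by
    rw [conjTranspose_fromRows_eq_fromCols_conjTranspose, fromRows_mul, fromRows_mul_fromCols, hY]
    congr 1
    rw [← hY, conjTranspose_mul, conjTranspose_mul, conjTranspose_conjTranspose,
      diagonal_conjTranspose, hstar, Matrix.mul_assoc]
  refine ⟨B * Vᴴ, B * diagonal s * Bᴴ, V * diagonal s * Vᴴ, ?_, ?_, ?_⟩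
  · have h1 : ‖B‖ * ‖B‖ ≤ 1 := by
      rw [← l2_opNorm_conjTranspose_mul_self, hBB, l2_opNorm_diagonal,
        pi_norm_le_iff_of_nonneg zero_le_one]
      intro i
      by_cases h : s i = 0 <;> simp [he, h]
    have h2 : ‖Vᴴ‖ * ‖Vᴴ‖ ≤ 1 := by
      rw [← l2_opNorm_conjTranspose_mul_self, conjTranspose_conjTranspose, hVV', ← diagonal_one,
        l2_opNorm_diagonal, pi_norm_le_iff_of_nonneg zero_le_one]
      simp
    refine (l2_opNorm_mul _ _).trans (mul_le_one₀ ?_ (norm_nonneg _) ?_) <;>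
      nlinarith [norm_nonneg B, norm_nonneg Vᴴ]
  · rw [hblock]
    refine PosSemidef.mul_mul_conjTranspose_same (PosSemidef.diagonal fun i => ?_) _
    exact Complex.zero_le_real.2 (Real.sqrt_nonneg _)
  · have hU : ((B * Vᴴ)ᴴ * Y).trace = (diagonal s).trace := by
      rw [conjTranspose_mul, conjTranspose_conjTranspose, Matrix.mul_assoc, trace_mul_comm,
        Matrix.mul_assoc, ← hZ, ← hZB, ← Matrix.mul_assoc, hBB, hes]
    have htr : ∀ (P : Matrix (Fin m) (Fin m) ℂ) (Q : Matrix (Fin n) (Fin n) ℂ),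
        (fromBlocks P Y Yᴴ Q).trace = P.trace + Q.trace := fun P Q => by
      simp [trace, Fintype.sum_sum_type]
    rw [hU, htr, trace_mul_comm, ← Matrix.mul_assoc, hBB, hes, trace_mul_comm,
      ← Matrix.mul_assoc, hVV, Matrix.one_mul, two_mul]

lemma vnorm_star {n : ℕ} (v : Fin n → ℂ) : vnorm (star v) = vnorm v := by
  simp [vnorm]

open scoped Matrix.Norms.L2Operator in
lemma opNorm_map_star_le {m n : ℕ} (U : Matrix (Fin m) (Fin n) ℂ) :
    opNorm (U.map star) ≤ ‖U‖ := by
  refine opNorm_le fun v hv => ?_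
  have h : U.map star *ᵥ v = star (U *ᵥ star v) := by
    ext i
    simp [mulVec, dotProduct]
  rw [h, vnorm_star]
  exact (vnorm_mulVec_le_l2 U _).trans
    (mul_le_of_le_one_right (norm_nonneg _) ((vnorm_star v).trans_le hv))

/-- Positive semidefinite matrices whose off-diagonal block is `X`. -/
def psdCompletions {m n : ℕ} (X : Matrix (Fin m) (Fin n) ℂ) :
    Set (Matrix (Fin m ⊕ Fin n) (Fin m ⊕ Fin n) ℂ) :=
  {M | M.PosSemidef ∧ ∀ i j, M (Sum.inl i) (Sum.inr j) = X i j}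

lemma exists_psdCompletion_sum_sq_le {m n : ℕ} (X : Matrix (Fin m) (Fin n) ℂ)
    {d : Fin m ⊕ Fin n → ℝ} (hd : ∀ i, 0 < d i) :
    ∃ M ∈ psdCompletions X,
      ∑ i, d i ^ 2 * (M i i).re ≤ schurNorm X * ∑ i, d i ^ 2 := by
  have hd0 : ∀ i, (d i : ℂ) ≠ 0 := fun i => Complex.ofReal_ne_zero.2 (hd i).ne'
  set Y : Matrix (Fin m) (Fin n) ℂ := Matrix.of fun i j =>
    (d (Sum.inl i) : ℂ) * X i j * d (Sum.inr j) with hY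
  obtain ⟨U, P, Q, hU, hpsd, htr⟩ := exists_posSemidef_fromBlocks_trace Y
  set N := fromBlocks P Y Yᴴ Q with hN
  set D : Matrix (Fin m ⊕ Fin n) (Fin m ⊕ Fin n) ℂ := diagonal fun i => (d i : ℂ)⁻¹ with hD
  have hM : ∀ i j, (D * N * Dᴴ) i j = (d i : ℂ)⁻¹ * N i j * (d j : ℂ)⁻¹ := fun i j => by
    rw [hD, diagonal_conjTranspose, mul_diagonal, diagonal_mul]
    simp
  refine ⟨D * N * Dᴴ, ⟨hpsd.mul_mul_conjTranspose_same D, fun i j => ?_⟩, ?_⟩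
  · rw [hM, hN, fromBlocks_apply₁₂, hY, Matrix.of_apply]
    have h1 := hd0 (Sum.inl i)
    have h2 := hd0 (Sum.inr j)
    field_simp
  · set l : Fin m → ℂ := fun i => d (Sum.inl i) with hl
    set r : Fin n → ℂ := fun j => d (Sum.inr j) with hr
    have htrace : ∑ i, d i ^ 2 * ((D * N * Dᴴ) i i).re = N.trace.re := by
      rw [trace, Complex.re_sum]
      refine Finset.sum_congr rfl fun i _ => ?_
      rw [← Complex.re_ofReal_mul, hM, diag_apply]
      congr 1
      have h1 := hd0 i
      push_cast
      field_simp
    have hpair : (Uᴴ * Y).trace = star l ⬝ᵥ (hadamard X (U.map star) *ᵥ r) := by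
      simp only [trace, diag_apply, mul_apply, conjTranspose_apply, dotProduct, mulVec,
        hadamard_apply, map_apply, Finset.mul_sum, hY, of_apply, Pi.star_apply, hl, hr]
      rw [Finset.sum_comm]
      refine Finset.sum_congr rfl fun i _ => Finset.sum_congr rfl fun j _ => ?_
      simp only [RCLike.star_def, Complex.conj_ofReal]
      ring
    have hsum : ∑ i, d i ^ 2 = vnorm l ^ 2 + vnorm r ^ 2 := by
      simp [Fintype.sum_sum_type, vnorm_sq, hl, hr]
    have hbound : (Uᴴ * Y).trace.re ≤ schurNorm X * (vnorm l * vnorm r) := by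
      refine (Complex.re_le_norm _).trans ?_
      rw [hpair]
      refine (norm_star_dotProduct_le _ _).trans ?_
      rw [mul_left_comm]
      refine mul_le_mul_of_nonneg_left ((vnorm_mulVec_le _ _).trans ?_) (vnorm_nonneg _)
      exact mul_le_mul_of_nonneg_right
        (opNorm_hadamard_le_schurNorm X ((opNorm_map_star_le U).trans hU)) (vnorm_nonneg _)
    have hre : N.trace.re = 2 * (Uᴴ * Y).trace.re := by
      rw [htr]
      simp
    rw [htrace, hre, hsum]
    nlinarith [mul_nonneg (schurNorm_nonneg X) (sq_nonneg (vnorm l - vnorm r))]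

lemma convex_psdCompletions {m n : ℕ} (X : Matrix (Fin m) (Fin n) ℂ) :
    Convex ℝ (psdCompletions X) := by
  rintro M ⟨hM, hMX⟩ N ⟨hN, hNX⟩ a b ha hb hab
  refine ⟨(hM.smul ha).add (hN.smul hb), fun i j => ?_⟩
  rw [Matrix.add_apply, Matrix.smul_apply, Matrix.smul_apply, hMX, hNX, ← add_smul, hab, one_smul]

lemma exists_psdCompletion_diag_lt {m n : ℕ} (X : Matrix (Fin m) (Fin n) ℂ) {c : ℝ}
    (hc : schurNorm X < c) : ∃ M ∈ psdCompletions X, ∀ i, (M i i).re < c := by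
  let K : Set (Fin m ⊕ Fin n → ℝ) := {p | ∃ M ∈ psdCompletions X, ∀ i, (M i i).re < p i}
  change (fun _ => c) ∈ K
  by_contra hcK
  have hconv : Convex ℝ K := by
    rintro p ⟨M, hM, hMp⟩ q ⟨N, hN, hNq⟩ a b ha hb hab
    refine ⟨a • M + b • N, convex_psdCompletions X hM hN ha hb hab, fun i => ?_⟩
    have h : ((a • M + b • N) i i).re = a * (M i i).re + b * (N i i).re := by simp
    rw [h, Pi.add_apply, Pi.smul_apply, Pi.smul_apply, smul_eq_mul, smul_eq_mul]
    rcases ha.eq_or_lt with rfl | ha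
    · have : b = 1 := by linarith
      subst this
      linarith [hNq i]
    · nlinarith [mul_lt_mul_of_pos_left (hMp i) ha, mul_le_mul_of_nonneg_left (hNq i).le hb]
  have hopen : IsOpen K := by
    have h : K = ⋃ M ∈ psdCompletions X, ⋂ i, {p | (M i i).re < p i} := by
      ext p
      simp only [K, Set.mem_ofPred_eq, Set.mem_iUnion, Set.mem_iInter, exists_prop]
    rw [h]
    exact isOpen_biUnion fun M _ => isOpen_iInter_of_finite fun i =>
      isOpen_lt continuous_const (continuous_apply i)
  obtain ⟨f, hf⟩ := geometric_hahn_banach_open_point hconv hopen hcK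
  set w : Fin m ⊕ Fin n → ℝ := fun i => -f (Pi.single i 1) with hw
  have hfw : ∀ p, f p = -∑ i, w i * p i := fun p => by
    have h := congrArg f (pi_eq_sum_univ' p)
    rw [h, map_sum, ← Finset.sum_neg_distrib]
    refine Finset.sum_congr rfl fun i _ => ?_
    rw [map_smul, smul_eq_mul, hw]
    simp [mul_comm]
  have hsep : ∀ p ∈ K, c * ∑ i, w i < ∑ i, w i * p i := fun p hp => by
    have h := hf p hp
    rw [hfw, hfw, ← Finset.sum_mul] at h
    linarith
  have hw0 : ∀ i, 0 ≤ w i := fun i => by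
    obtain ⟨M, hM, -⟩ := exists_psdCompletion_sum_sq_le X (d := fun _ => 1) fun _ => one_pos
    by_contra! hneg
    set p : Fin m ⊕ Fin n → ℝ := fun i => (M i i).re + 1 with hp
    set A := ∑ j, w j * p j - c * ∑ j, w j
    have h1 := hsep p ⟨M, hM, fun j => by simp [hp]⟩
    have hA0 : 0 < A := by linarith
    have h2 := hsep (p + Pi.single i (A / -w i)) ⟨M, hM, fun j => by
      have h : 0 ≤ (Pi.single i (A / -w i) : Fin m ⊕ Fin n → ℝ) j := by
        have : 0 ≤ (Pi.single i (A / -w i) : Fin m ⊕ Fin n → ℝ) :=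
          Pi.single_nonneg.2 (div_nonneg hA0.le (by linarith))
        exact this j
      simp only [Pi.add_apply, hp]
      linarith⟩
    have h3 : ∑ j, w j * (p + Pi.single i (A / -w i) : Fin m ⊕ Fin n → ℝ) j =
        ∑ j, w j * p j - A := by
      simp only [Pi.add_apply, mul_add, Finset.sum_add_distrib, Pi.single_apply, mul_ite, mul_zero,
        Finset.sum_ite_eq', Finset.mem_univ, if_true]
      have : w i * (A / -w i) = -A := by
        have := hneg.ne
        field_simp
      rw [this, sub_eq_add_neg]
    linarith
  set s := schurNorm X
  set S := ∑ i, w i with hS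
  have hS0 : 0 ≤ S := Finset.sum_nonneg fun i _ => hw0 i
  have hs0 : 0 ≤ s := schurNorm_nonneg X
  set C := s * Fintype.card (Fin m ⊕ Fin n) + S with hC
  have key : ∀ δ > 0, c * S < s * S + δ * C := fun δ hδ => by
    obtain ⟨M, hM, hMle⟩ := exists_psdCompletion_sum_sq_le X (d := fun i => √(w i + δ))
      fun i => Real.sqrt_pos.2 (by linarith [hw0 i])
    have hsq : ∀ i, √(w i + δ) ^ 2 = w i + δ := fun i => Real.sq_sqrt (by linarith [hw0 i])
    simp only [hsq] at hMle
    have h1 := hsep (fun i => (M i i).re + δ) ⟨M, hM, fun i => by linarith⟩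
    have h2 : ∑ i, w i * ((M i i).re + δ) ≤ ∑ i, (w i + δ) * (M i i).re + S * δ := by
      rw [hS, Finset.sum_mul, ← Finset.sum_add_distrib]
      refine Finset.sum_le_sum fun i _ => ?_
      have : 0 ≤ (M i i).re := (Complex.le_def.1 hM.1.diag_nonneg).1
      nlinarith
    have h3 : ∑ i, (w i + δ) = S + Fintype.card (Fin m ⊕ Fin n) * δ := by
      rw [Finset.sum_add_distrib, Finset.sum_const, Finset.card_univ, nsmul_eq_mul]
    rw [h3] at hMle
    rw [hC]
    linarith
  have hC0 : 0 ≤ C := by positivity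
  have hle : (c - s) * S ≤ 0 := by
    refine le_of_forall_pos_le_add fun ε hε => ?_
    have h1 := key (ε / (C + 1)) (by positivity)
    have h2 : ε / (C + 1) * C ≤ ε := by
      rw [div_mul_eq_mul_div, div_le_iff₀ (by positivity)]
      nlinarith
    linarith
  have hSz : S = 0 := le_antisymm (nonpos_of_mul_nonpos_right hle (sub_pos.2 hc)) hS0
  obtain ⟨M, hM, -⟩ := exists_psdCompletion_sum_sq_le X (d := fun _ => 1) fun _ => one_pos
  have h1 := hsep (fun i => (M i i).re + 1) ⟨M, hM, fun i => by linarith⟩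
  rw [hS, Finset.sum_eq_zero_iff_of_nonneg fun i _ => hw0 i] at hSz
  simp [S, fun i => hSz i (Finset.mem_univ i)] at h1

open scoped MatrixOrder Matrix.Norms.L2Operator in
lemma _root_.Matrix.PosSemidef.exists_eq_conjTranspose_mul_self {ι : Type*} [Fintype ι]
    [DecidableEq ι] {M : Matrix ι ι ℂ} (hM : M.PosSemidef) : ∃ B : Matrix ι ι ℂ, M = Bᴴ * B :=
  CStarAlgebra.nonneg_iff_eq_star_mul_self.mp hM.nonneg

/-- The Gram matrix of the columns of `B` has off-diagonal block `X`, where every column of `B`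
has squared `ℓ²` norm at most `schurNorm X`. -/
lemma exists_gram_factorization {m n : ℕ} (X : Matrix (Fin m) (Fin n) ℂ) :
    ∃ B : Matrix (Fin m ⊕ Fin n) (Fin m ⊕ Fin n) ℂ,
      (∀ i, ∑ l, ‖B l i‖ ^ 2 ≤ schurNorm X) ∧
      ∀ i j, (Bᴴ * B) (Sum.inl i) (Sum.inr j) = X i j := by
  set s := schurNorm X
  let T : ℕ → Set (Matrix (Fin m ⊕ Fin n) (Fin m ⊕ Fin n) ℂ) := fun t =>
    {B | ∀ i, ∑ l, ‖B l i‖ ^ 2 ≤ s + 1 / ((t : ℝ) + 1)} ∩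
      {B | ∀ i j, (Bᴴ * B) (Sum.inl i) (Sum.inr j) = X i j}
  have hclosed : ∀ t, IsClosed (T t) := fun t => by
    refine IsClosed.inter ?_ ?_
    · simp only [Set.ofPred_forall]
      refine isClosed_iInter fun i => isClosed_le ?_ continuous_const
      exact continuous_finsetSum _ fun l _ => ((continuous_id.matrix_elem l i).norm).pow 2
    · simp only [Set.ofPred_forall]
      refine isClosed_iInter fun i => isClosed_iInter fun j => isClosed_eq ?_ continuous_const
      exact (continuous_id.matrix_conjTranspose.matrix_mul continuous_id).matrix_elem _ _
  have hcompact : IsCompact (T 0) := by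
    have hbox : IsCompact (Set.univ.pi fun _ : Fin m ⊕ Fin n => Set.univ.pi
        fun _ : Fin m ⊕ Fin n => Metric.closedBall (0 : ℂ) √(s + 1)) :=
      isCompact_univ_pi fun _ => isCompact_univ_pi fun _ => isCompact_closedBall _ _
    refine hbox.of_isClosed_subset (hclosed 0) fun B hB l _ i _ => ?_
    rw [mem_closedBall_zero_iff]
    refine Real.le_sqrt_of_sq_le ?_
    have h := (Finset.single_le_sum (f := fun l => ‖B l i‖ ^ 2) (fun _ _ => sq_nonneg _)
      (Finset.mem_univ l)).trans (hB.1 i)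
    simpa using h
  obtain ⟨B, hB⟩ := IsCompact.nonempty_iInter_of_sequence_nonempty_isCompact_isClosed T
    (fun t B hB => ⟨fun i => (hB.1 i).trans (by
      push_cast
      gcongr
      linarith), hB.2⟩)
    (fun t => by
      obtain ⟨M, ⟨hM, hMX⟩, hlt⟩ := exists_psdCompletion_diag_lt X
        (c := s + 1 / ((t : ℝ) + 1)) (lt_add_of_pos_right s Nat.one_div_pos_of_nat)
      obtain ⟨B, rfl⟩ := hM.exists_eq_conjTranspose_mul_self
      refine ⟨B, fun i => ?_, hMX⟩
      have h : ((Bᴴ * B) i i) = ((∑ l, ‖B l i‖ ^ 2 : ℝ) : ℂ) := by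
        simp [mul_apply, Complex.conj_mul']
      have := hlt i
      rw [h, Complex.ofReal_re] at this
      exact this.le)
    hcompact hclosed
  rw [Set.mem_iInter] at hB
  refine ⟨B, fun i => ?_, (hB 0).2⟩
  have hlim : Filter.Tendsto (fun t : ℕ => s + 1 / ((t : ℝ) + 1)) Filter.atTop (nhds (s + 0)) :=
    tendsto_const_nhds.add tendsto_one_div_add_atTop_nhds_zero_nat
  rw [add_zero] at hlim
  exact ge_of_tendsto' hlim fun t => (hB t).1 i

/-- Two families of vectors can be replaced by families in `ℂᵏ` with the same mutual inner
products, no larger norms, and a common span, as soon as `k` bounds the rank of the matrix of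
inner products. -/
lemma exists_reduced_families {m n k : ℕ} {E : Type*} [NormedAddCommGroup E]
    [InnerProductSpace ℂ E] [FiniteDimensional ℂ E] (X : Matrix (Fin m) (Fin n) ℂ)
    (hk : X.rank ≤ k) (x : Fin m → E) (y : Fin n → E) (hX : ∀ i j, inner ℂ (x i) (y j) = X i j) :
    ∃ (x' : Fin m → EuclideanSpace ℂ (Fin k)) (y' : Fin n → EuclideanSpace ℂ (Fin k)),
      (∀ i j, inner ℂ (x' i) (y' j) = X i j) ∧ (∀ i, ‖x' i‖ ≤ ‖x i‖) ∧ (∀ j, ‖y' j‖ ≤ ‖y j‖) ∧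
      Submodule.span ℂ (Set.range x') = Submodule.span ℂ (Set.range y') := by
  set F := Submodule.span ℂ (Set.range y) with hF
  set x₁ : Fin m → E := fun i => F.starProjection (x i) with hx₁
  set G := Submodule.span ℂ (Set.range x₁)
  have hGF : G ≤ F := Submodule.span_le.2 (by
    rintro _ ⟨i, rfl⟩
    exact Submodule.starProjection_apply_mem F (x i))
  set u : Fin m → G := fun i => ⟨x₁ i, Submodule.subset_span ⟨i, rfl⟩⟩
  set v : Fin n → G := fun j => G.orthogonalProjectionOnto (y j) with hv
  have huspan : Submodule.span ℂ (Set.range u) = ⊤ := by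
    apply Submodule.map_injective_of_injective G.injective_subtype
    rw [Submodule.map_span, ← Set.range_comp, Submodule.map_top, Submodule.range_subtype]
    rfl
  have hvspan : Submodule.span ℂ (Set.range v) = ⊤ := by
    have h : Submodule.span ℂ (Set.range v) = F.map (G.orthogonalProjectionOnto : E →ₗ[ℂ] G) := by
      rw [hF, Submodule.map_span, ← Set.range_comp]
      rfl
    rw [h, eq_top_iff]
    intro g _
    exact ⟨g, hGF g.2, by simp⟩
  have huv : ∀ i j, inner ℂ (u i) (v j) = X i j := fun i j => by
    have h1 : inner ℂ (u i) (v j) = inner ℂ (x₁ i) (y j) := by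
      rw [hv, Submodule.inner_orthogonalProjectionOnto_eq_of_mem_left]
    rw [h1, ← hX, hx₁, Submodule.inner_starProjection_left_eq_right,
      Submodule.starProjection_eq_self_iff.2 (Submodule.subset_span (Set.mem_range_self j))]
  have hrank : Module.finrank ℂ G ≤ k := by
    let S : G →ₗ[ℂ] (Fin m → ℂ) := LinearMap.pi fun i => (innerSL ℂ (u i)).toLinearMap
    have hS : Function.Injective S := by
      rw [injective_iff_map_eq_zero]
      intro g hg
      have h : ∀ w ∈ Submodule.span ℂ (Set.range u), inner ℂ w g = 0 := fun w hw => by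
        induction hw using Submodule.span_induction with
        | mem w hw =>
          obtain ⟨i, rfl⟩ := hw
          exact congrFun hg i
        | zero => exact inner_zero_left g
        | add a b _ _ ha hb => rw [inner_add_left, ha, hb, add_zero]
        | smul c a _ ha => rw [inner_smul_left, ha, mul_zero]
      exact inner_self_eq_zero.1 (h g (huspan ▸ Submodule.mem_top))
    have hcols : Submodule.span ℂ (Set.range X.col) = Submodule.map S ⊤ := by
      rw [← hvspan, Submodule.map_span, ← Set.range_comp]
      congr 2
      ext j i
      exact (huv i j).symm
    rw [rank_eq_finrank_span_cols, hcols, Submodule.map_top,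
      LinearMap.finrank_range_of_inj hS] at hk
    exact hk
  let b := stdOrthonormalBasis ℂ G
  have horth : Orthonormal ℂ fun i => EuclideanSpace.basisFun (Fin k) ℂ (Fin.castLE hrank i) :=
    (EuclideanSpace.basisFun (Fin k) ℂ).orthonormal.comp _ (Fin.castLE_injective hrank)
  let W : G →ₗᵢ[ℂ] EuclideanSpace ℂ (Fin k) :=
    LinearMap.isometryOfOrthonormal (v := b.toBasis)
      (b.toBasis.constr ℂ fun i => EuclideanSpace.basisFun (Fin k) ℂ (Fin.castLE hrank i))
      (by simp)
      (by
        convert horth using 1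
        ext1 i
        exact b.toBasis.constr_basis ℂ _ i)
  have hWspan : ∀ {ι : Type} (z : ι → G), Submodule.span ℂ (Set.range z) = ⊤ →
      Submodule.span ℂ (Set.range fun i => W (z i)) = Submodule.map W.toLinearMap ⊤ :=
    fun z hz => by
      rw [← hz, Submodule.map_span, ← Set.range_comp]
      rfl
  refine ⟨fun i => W (u i), fun j => W (v j), fun i j => ?_, fun i => ?_, fun j => ?_, ?_⟩
  · rw [W.inner_map_map, huv]
  · rw [W.norm_map]
    exact F.norm_starProjection_apply_le (x i)
  · rw [W.norm_map]
    exact G.norm_orthogonalProjectionOnto_apply_le (y j)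
  · rw [hWspan u huspan, hWspan v hvspan]

lemma ran_eq_map_span {m n : ℕ} (z : Fin n → EuclideanSpace ℂ (Fin m)) :
    ran (Matrix.of fun i j => z j i) = (Submodule.span ℂ (Set.range z)).map
      (WithLp.linearEquiv 2 ℂ (Fin m → ℂ)).toLinearMap := by
  rw [ran, Matrix.range_mulVecLin, Submodule.map_span, ← Set.range_comp]
  rfl

lemma colNorm_of_le {m n : ℕ} {z : Fin n → EuclideanSpace ℂ (Fin m)} {c : ℝ} (hc : 0 ≤ c)
    (hz : ∀ j, ‖z j‖ ≤ c) : colNorm (Matrix.of fun i j => z j i) ≤ c :=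
  colNorm_le hc fun j => (vnorm_eq_norm _).trans_le (hz j)

theorem stmt0 {m n k : ℕ} (X : Matrix (Fin m) (Fin n) ℂ) (hk : X.rank ≤ k) :
    (∃ (L : Matrix (Fin k) (Fin m) ℂ) (R : Matrix (Fin k) (Fin n) ℂ),
      X = Lᴴ * R ∧ schurNorm X = colNorm L * colNorm R ∧ ran L = ran R) ∧
    (∀ (k' : ℕ) (L : Matrix (Fin k') (Fin m) ℂ) (R : Matrix (Fin k') (Fin n) ℂ),
      X = Lᴴ * R → schurNorm X ≤ colNorm L * colNorm R) := by
  refine ⟨?_, fun k' L R hLR => hLR ▸ schurNorm_le L R⟩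
  obtain ⟨B, hB, hBX⟩ := exists_gram_factorization X
  have hnorm : ∀ i, ‖WithLp.toLp 2 (fun l => B l i)‖ ≤ √(schurNorm X) := fun i => by
    rw [EuclideanSpace.norm_eq]
    exact Real.sqrt_le_sqrt (hB i)
  obtain ⟨x, y, hxy, hx, hy, hspan⟩ := exists_reduced_families X hk
    (fun i => WithLp.toLp 2 fun l => B l (Sum.inl i))
    (fun j => WithLp.toLp 2 fun l => B l (Sum.inr j)) fun i j => by
      rw [← hBX, EuclideanSpace.inner_toLp_toLp, mul_apply, dotProduct_comm]
      rfl
  have hX : X = (Matrix.of fun l i => x i l)ᴴ * Matrix.of fun l j => y j l := by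
    ext i j
    rw [← hxy, EuclideanSpace.inner_eq_star_dotProduct, mul_apply, dotProduct_comm]
    rfl
  refine ⟨Matrix.of fun l i => x i l, Matrix.of fun l j => y j l, hX, le_antisymm ?_ ?_, ?_⟩
  · conv_lhs => rw [hX]
    exact schurNorm_le _ _
  · rw [← Real.mul_self_sqrt (schurNorm_nonneg X)]
    exact mul_le_mul (colNorm_of_le (Real.sqrt_nonneg _) fun i => (hx i).trans (hnorm _))
      (colNorm_of_le (Real.sqrt_nonneg _) fun j => (hy j).trans (hnorm _)) (colNorm_nonneg _)
      (Real.sqrt_nonneg _)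
  · rw [ran_eq_map_span, ran_eq_map_span, hspan]

end MatFact
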